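/- Let N ≥ 3 and let A be the (N+1)×(N+1) matrix equal to the P_N closure matrix except that its last row is (0,…,0, a_{N−3}, a_{N−2}, a_{N−1}, a_N). If a_{N−3} > −(N−1)(N−2)/(N(2N−3)) and a_{N−1} > g(a_{N−3},a_{N−2},a_N;N)/((N−2)(a_{N−3}(2N−3)N + (N−1)(N−2))²), where g = a_{N−3}³(N−1)N²(3−2N)² + a_{N−2}(2N−1)(N−2)³(a_{N−2}N − a_N(N−1)) + a_{N−3}(N−2)²(a_N(4N²−8N+3)(a_{N−2}N − a_N(N−1)) + (N−1)³) + 2a_{N−3}²(N−1)²N(2N−3)(N−2), then there exists a symmetric positive definite matrix A₀ = diag(1,3,…,2N−5, B) with B a 3×3 symmetric positive definite matrix such that A₀A is symmetric; hence A is real diagonalizable. -/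

import Mathlib

open Matrix

def RealDiagonalizable {n : ℕ} (A : Matrix (Fin n) (Fin n) ℝ) : Prop :=
  ∃ P D : Matrix (Fin n) (Fin n) ℝ, IsUnit P.det ∧ D.IsDiag ∧ A = P⁻¹ * D * P

noncomputable def closureMatrix (N : ℕ) (lastRow : Fin (N + 1) → ℝ) :
    Matrix (Fin (N + 1)) (Fin (N + 1)) ℝ := fun i j =>
  if (i : ℕ) = N then lastRow j
  else if (j : ℕ) = (i : ℕ) + 1 then (((i : ℕ) : ℝ) + 1) / (2 * ((i : ℕ) : ℝ) + 1)
  else if (i : ℕ) = (j : ℕ) + 1 then ((i : ℕ) : ℝ) / (2 * ((i : ℕ) : ℝ) + 1)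
  else 0

/-- The polynomial `g(a_{N-3}, a_{N-2}, a_N; N)` appearing in the 4-degree-of-freedom
hyperbolicity constraint. -/
def gPoly (a3 a2 a0 NR : ℝ) : ℝ :=
  a3 ^ 3 * (NR - 1) * NR ^ 2 * (3 - 2 * NR) ^ 2 +
    a2 * (2 * NR - 1) * (NR - 2) ^ 3 * (a2 * NR - a0 * (NR - 1)) +
    a3 * (NR - 2) ^ 2 *
      (a0 * (4 * NR ^ 2 - 8 * NR + 3) * (a2 * NR - a0 * (NR - 1)) + (NR - 1) ^ 3) +
    2 * a3 ^ 2 * (NR - 1) ^ 2 * NR * (2 * NR - 3) * (NR - 2)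


open scoped MatrixOrder in
theorem realDiag_of_symmetrizer {n : ℕ} (A S : Matrix (Fin n) (Fin n) ℝ) (hS : S.PosDef)
    (hSA : (S * A).IsSymm) : RealDiagonalizable A := by
  obtain ⟨Q, hQ⟩ := CStarAlgebra.nonneg_iff_eq_star_mul_self.mp hS.posSemidef.nonneg
  rw [Matrix.star_eq_conjTranspose, Matrix.conjTranspose_eq_transpose_of_trivial] at hQ
  have hdet : Q.det ≠ 0 := by
    have h := hS.det_pos
    rw [hQ, det_mul, det_transpose] at h
    intro h0
    simp [h0] at h
  have hu : IsUnit Q.det := isUnit_iff_ne_zero.mpr hdet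
  have hut : IsUnit Qᵀ.det := by rwa [det_transpose]
  have hC : (Q * A * Q⁻¹) = (Q⁻¹)ᵀ * (S * A) * Q⁻¹ := by
    rw [hQ, transpose_nonsing_inv]
    simp only [← Matrix.mul_assoc]
    rw [nonsing_inv_mul _ hut, Matrix.one_mul]
  have hH : (Q * A * Q⁻¹).IsHermitian := by
    rw [hC]
    unfold Matrix.IsHermitian
    rw [Matrix.conjTranspose_eq_transpose_of_trivial]
    rw [transpose_mul, transpose_mul, hSA.eq, transpose_transpose, ← Matrix.mul_assoc (Q⁻¹)ᵀ]
  set C := Q * A * Q⁻¹ with hCdef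
  let U : Matrix (Fin n) (Fin n) ℝ := hH.eigenvectorUnitary
  have hU1 : star U * U = 1 := Unitary.coe_star_mul_self hH.eigenvectorUnitary
  have hU2 : U * star U = 1 := Unitary.coe_mul_star_self hH.eigenvectorUnitary
  have hspec : C = U * diagonal hH.eigenvalues * star U := by
    have := hH.spectral_theorem
    rw [Unitary.conjStarAlgAut_apply] at this
    simpa using this
  have hinv : (star U * Q)⁻¹ = Q⁻¹ * U := by
    apply inv_eq_right_inv
    calc star U * Q * (Q⁻¹ * U) = star U * (Q * Q⁻¹) * U := by simp only [Matrix.mul_assoc]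
      _ = 1 := by rw [mul_nonsing_inv _ hu, Matrix.mul_one, hU1]
  refine ⟨star U * Q, diagonal hH.eigenvalues, ?_, isDiag_diagonal _, ?_⟩
  · rw [det_mul]
    refine IsUnit.mul ?_ hu
    exact IsUnit.of_mul_eq_one U.det (by rw [← det_mul, hU1, det_one])
  · rw [hinv]
    calc A = (Q⁻¹ * Q) * A * (Q⁻¹ * Q) := by
          rw [nonsing_inv_mul _ hu, Matrix.one_mul, Matrix.mul_one]
      _ = Q⁻¹ * C * Q := by rw [hCdef]; simp only [Matrix.mul_assoc]
      _ = Q⁻¹ * (U * diagonal hH.eigenvalues * star U) * Q := congrArg (fun X => Q⁻¹ * X * Q) hspec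
      _ = _ := by simp only [Matrix.mul_assoc]

theorem posDef_diag_add {n : ℕ} (d l : Fin (n + 1) → ℝ) (w : ℝ) (hw : 0 < w)
    (hd : ∀ i, i ≠ Fin.last n → 0 < d i) (hd0 : d (Fin.last n) = 0) (hl : l (Fin.last n) = 1) :
    (diagonal d + w • vecMulVec l l).PosDef := by
  have hdn : ∀ i, 0 ≤ d i := fun i => by
    by_cases h : i = Fin.last n
    · rw [h, hd0]
    · exact (hd i h).le
  refine Matrix.PosDef.of_dotProduct_mulVec_pos ?_ ?_
  · ext i j
    by_cases h : i = j
    · subst h; simp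
    · simp [vecMulVec_apply, diagonal_apply, h, Ne.symm h, mul_comm]
  · intro x hx
    have hform : star x ⬝ᵥ ((diagonal d + w • vecMulVec l l) *ᵥ x)
        = ∑ i, d i * x i ^ 2 + w * (l ⬝ᵥ x) ^ 2 := by
      rw [add_mulVec, dotProduct_add, smul_mulVec, vecMulVec_mulVec, dotProduct_smul]
      congr 1
      · simp only [dotProduct, mulVec_diagonal, star_trivial]
        exact Finset.sum_congr rfl fun i _ => by ring
      · simp only [star_trivial, dotProduct_comm x l, smul_eq_mul, dotProduct_smul,
          MulOpposite.smul_eq_mul_unop, MulOpposite.unop_op, op_smul_eq_smul]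
        ring
    rw [hform]
    have h1 : 0 ≤ ∑ i, d i * x i ^ 2 :=
      Finset.sum_nonneg fun i _ => mul_nonneg (hdn i) (sq_nonneg _)
    have h2 : 0 ≤ w * (l ⬝ᵥ x) ^ 2 := by positivity
    by_contra hneg
    have e1 : ∑ i, d i * x i ^ 2 = 0 := by linarith
    have e2 : w * (l ⬝ᵥ x) ^ 2 = 0 := by linarith
    rw [Finset.sum_eq_zero_iff_of_nonneg
      (fun i _ => mul_nonneg (hdn i) (sq_nonneg _))] at e1
    have hz : ∀ i, i ≠ Fin.last n → x i = 0 := fun i hi => by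
      have := e1 i (Finset.mem_univ _)
      have hdi := (hd i hi).ne'
      simpa [hdi] using this
    have e3 : l ⬝ᵥ x = 0 := by simpa [hw.ne'] using e2
    have e4 : l ⬝ᵥ x = x (Fin.last n) := by
      rw [dotProduct, Finset.sum_eq_single (Fin.last n)]
      · rw [hl, one_mul]
      · intro i _ hi; rw [hz i hi, mul_zero]
      · simp
    apply hx
    ext i
    by_cases h : i = Fin.last n
    · rw [h, ← e4, e3]; rfl
    · exact hz i h

set_option maxHeartbeats 4000000 in
/-- Theorem 2.1: global hyperbolicity of the 4-degree-of-freedom ML closure. Under the two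
constraints on `a_{N-3}` and `a_{N-1}`, there exists a symmetrizer
`A₀ = diag(1, 3, …, 2N-5, B)` with `B` a `3×3` SPD block such that `A₀ * A` is symmetric;
hence `A` is real diagonalizable. -/
theorem closure_dof4_hyperbolic (N : ℕ) (hN : 3 ≤ N) (a3 a2 a1 a0 : ℝ)
    (h3 : a3 > -(((N : ℝ) - 1) * ((N : ℝ) - 2)) / ((N : ℝ) * (2 * (N : ℝ) - 3)))
    (h1 : a1 > gPoly a3 a2 a0 (N : ℝ) /
      (((N : ℝ) - 2) * (a3 * (2 * (N : ℝ) - 3) * (N : ℝ) +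
        ((N : ℝ) - 1) * ((N : ℝ) - 2)) ^ 2)) :
    let A := closureMatrix N fun j =>
      if (j : ℕ) = N - 3 then a3 else if (j : ℕ) = N - 2 then a2
      else if (j : ℕ) = N - 1 then a1 else if (j : ℕ) = N then a0 else 0
    ∃ A₀ : Matrix (Fin (N + 1)) (Fin (N + 1)) ℝ,
      A₀.PosDef ∧
      (∀ i j : Fin (N + 1), (i : ℕ) < N - 2 → i ≠ j → A₀ i j = 0) ∧
      (∀ i : Fin (N + 1), (i : ℕ) < N - 2 → A₀ i i = 2 * ((i : ℕ) : ℝ) + 1) ∧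
      (A₀ * A).IsSymm ∧ RealDiagonalizable A := by
  intro A
  obtain ⟨M, rfl⟩ : ∃ M, N = M + 3 := ⟨N - 3, by omega⟩
  set m : ℝ := (M : ℝ) with hm
  have hm0 : 0 ≤ m := Nat.cast_nonneg M
  have hNm : ((M + 3 : ℕ) : ℝ) = m + 3 := by push_cast; rfl
  rw [hNm] at h3 h1
  have hp1 : m + 1 ≠ 0 := by positivity
  have hp2 : m + 2 ≠ 0 := by positivity
  have hp3 : m + 3 ≠ 0 := by positivity
  have hq1 : 2 * m + 1 ≠ 0 := by positivity
  have hq3 : 2 * m + 3 ≠ 0 := by positivity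
  have hq5 : 2 * m + 5 ≠ 0 := by positivity
  obtain ⟨K, hK⟩ : ∃ K, K = a3 * (2 * m + 3) * (m + 3) + (m + 2) * (m + 1) := ⟨_, rfl⟩
  have hKpos : 0 < K := by
    have hden : 0 < (m + 3) * (2 * (m + 3) - 3) := by
      have : 2 * (m + 3) - 3 = 2 * m + 3 := by ring
      rw [this]; positivity
    rw [gt_iff_lt, div_lt_iff₀ hden] at h3
    rw [hK]; nlinarith
  have hK0 := hKpos.ne'
  obtain ⟨k, hk⟩ : ∃ k, k = (2 * m + 5) * ((m + 1) * a2 + (2 * m + 3) * a3 * a0) / K := ⟨_, rfl⟩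
  have hkK : k * K = (2 * m + 5) * ((m + 1) * a2 + (2 * m + 3) * a3 * a0) := by
    rw [hk]; field_simp
  obtain ⟨r, hr⟩ : ∃ r, r = (m + 3) / (2 * m + 5) := ⟨_, rfl⟩
  have hrpos : 0 < r := by rw [hr]; positivity
  obtain ⟨q, hq⟩ : ∃ q, q = (m + 2) / (2 * m + 5) := ⟨_, rfl⟩
  obtain ⟨p, hp⟩ : ∃ p, p = (m + 2) / (2 * m + 3) := ⟨_, rfl⟩
  obtain ⟨c, hc⟩ : ∃ c, c = (m + 1) / (2 * m + 3) := ⟨_, rfl⟩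
  have hcpos : 0 < c := by rw [hc]; positivity
  obtain ⟨S, hS⟩ : ∃ S, S = a1 - a3 / c * p + k * (a0 - k * r) := ⟨_, rfl⟩
  have hSpos : 0 < S := by
    have hg : gPoly a3 a2 a0 (m + 3) / ((m + 3 - 2) * (a3 * (2 * (m + 3) - 3) * (m + 3) +
        (m + 3 - 1) * (m + 3 - 2)) ^ 2) = a3 / c * p - k * (a0 - k * r) := by
      have e1 : a3 * (2 * (m + 3) - 3) * (m + 3) + (m + 3 - 1) * (m + 3 - 2) = K := by
        rw [hK]; ring
      have e2 : m + 3 - 2 = m + 1 := by ring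
      rw [e1, e2, hk, hc, hp, hr]
      unfold gPoly
      field_simp
      rw [hK]
      ring
    rw [hg] at h1
    rw [hS]; linarith
  have hS0 := hSpos.ne'
  obtain ⟨w, hw⟩ : ∃ w, w = (m + 1) * (m + 2) * (m + 3) / (K * S) := ⟨_, rfl⟩
  have hwpos : 0 < w := by rw [hw]; positivity
  have hwKS : w * (K * S) = (m + 1) * (m + 2) * (m + 3) := by rw [hw]; field_simp
  -- the three algebraic identities
  have I2 : -(a3 / c) * (a0 - k * r) = a2 - k * q := by
    have : (a3 / c) * (a0 - k * r) + (a2 - k * q) = 0 := by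
      rw [hc, hr, hq, hk]
      field_simp
      rw [hK]; ring
    linarith
  have I3 : w * S / r * r + w * (-k) * (a0 - k * r) = w * (a1 - a3 / c * p) := by
    rw [div_mul_cancel₀ _ hrpos.ne', hS]; ring
  have I1 : (m + 2) + w * (-(a3 / c)) * (a1 - a3 / c * p) =
      w * S / r * q + w * (-k) * (a2 - k * q) := by
    rw [← I2]
    have hX : a1 - a3 / c * p = S - k * (a0 - k * r) := by rw [hS]; ring
    rw [hX]
    have : (m + 2) = w * S * (q / r + a3 / c) := by
      have e : q / r + a3 / c = K / ((m + 1) * (m + 3)) := by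
        rw [hq, hr, hc, hK]; field_simp; ring
      rw [e]
      field_simp
      linarith
    rw [this]; ring
  let d : Fin (M + 3 + 1) → ℝ := fun i =>
    if (i : ℕ) = M + 3 then 0 else if (i : ℕ) = M + 2 then w * S / r else 2 * ((i : ℕ) : ℝ) + 1
  let l : Fin (M + 3 + 1) → ℝ := fun i =>
    if (i : ℕ) = M + 3 then 1 else if (i : ℕ) = M + 2 then -k
    else if (i : ℕ) = M + 1 then -(a3 / c) else 0
  let μ : Fin (M + 3 + 1) → ℝ := fun i =>
    if (i : ℕ) = M + 3 then a0 - k * r else if (i : ℕ) = M + 2 then a1 - a3 / c * p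
    else if (i : ℕ) = M + 1 then a2 - k * q else 0
  have hpd : (diagonal d + w • vecMulVec l l).PosDef := by
    apply posDef_diag_add _ _ _ hwpos
    · intro i hi
      have hi' : (i : ℕ) ≠ M + 3 := fun h => hi (Fin.ext h)
      simp only [d, if_neg hi']
      split_ifs
      · positivity
      · positivity
    · simp [d]
    · simp [l]
  have hlA : l ᵥ* A = μ := by
    ext j
    have hsum : (l ᵥ* A) j = -(a3 / c) * A ⟨M + 1, by omega⟩ j + -k * A ⟨M + 2, by omega⟩ j
        + A ⟨M + 3, by omega⟩ j := by
      rw [vecMul, dotProduct, Fin.sum_univ_castSucc, Fin.sum_univ_castSucc, Fin.sum_univ_castSucc,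
        Finset.sum_eq_zero]
      · simp [l, Fin.last]
      · intro i _
        have := i.2
        have h1 : (i : ℕ) ≠ M + 3 := by omega
        have h2 : (i : ℕ) ≠ M + 2 := by omega
        have h3 : (i : ℕ) ≠ M + 1 := by omega
        simp [l, h1, h2, h3]
    rw [hsum]
    obtain ⟨j, hj⟩ := j
    have hcases : j < M ∨ j = M ∨ j = M + 1 ∨ j = M + 2 ∨ j = M + 3 := by omega
    have ec : ((M : ℝ) + 1) / (2 * ((M : ℝ) + 1) + 1) = c := by rw [hc, hm]; ring_nf
    have ep : ((M : ℝ) + 1 + 1) / (2 * ((M : ℝ) + 1) + 1) = p := by rw [hp, hm]; ring_nf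
    have eq : ((M : ℝ) + 2) / (2 * ((M : ℝ) + 2) + 1) = q := by rw [hq, hm]; ring_nf
    have er : ((M : ℝ) + 2 + 1) / (2 * ((M : ℝ) + 2) + 1) = r := by rw [hr, hm]; ring_nf
    have hc0 := hcpos.ne'
    rcases hcases with h | h | h | h | h
    · try subst h
      simp only [A, closureMatrix, μ]
      split_ifs <;> first | omega | skip
      push_cast
      try rw [ec]
      try rw [ep]
      try rw [eq]
      try rw [er]
      try field_simp
      try ring
    · try subst h
      simp only [A, closureMatrix, μ]
      split_ifs <;> first | omega | skip
      push_cast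
      try rw [ec]
      try rw [ep]
      try rw [eq]
      try rw [er]
      try field_simp
      try ring
    · try subst h
      simp only [A, closureMatrix, μ]
      split_ifs <;> first | omega | skip
      push_cast
      try rw [ec]
      try rw [ep]
      try rw [eq]
      try rw [er]
      try field_simp
      try ring
    · try subst h
      simp only [A, closureMatrix, μ]
      split_ifs <;> first | omega | skip
      push_cast
      try rw [ec]
      try rw [ep]
      try rw [eq]
      try rw [er]
      try field_simp
      try ring
    · try subst h
      simp only [A, closureMatrix, μ]
      split_ifs <;> first | omega | skip
      push_cast
      try rw [ec]
      try rw [ep]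
      try rw [eq]
      try rw [er]
      try field_simp
      try ring
  have hentry : ∀ i j, ((diagonal d + w • vecMulVec l l) * A) i j
      = d i * A i j + w * l i * μ j := by
    intro i j
    rw [Matrix.add_mul, Matrix.add_apply, diagonal_mul, smul_mul, vecMulVec_mul, hlA,
      Matrix.smul_apply, vecMulVec_apply, smul_eq_mul, mul_assoc]
  have hsym : ((diagonal d + w • vecMulVec l l) * A).IsSymm := by
    have key : ∀ i j : Fin (M + 3 + 1), (i : ℕ) < j →
        d i * A i j + w * l i * μ j = d j * A j i + w * l j * μ i := by
      rintro ⟨i, hi⟩ ⟨j, hj⟩ hij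
      simp only at hij
      have ep : ((M : ℝ) + 1 + 1) / (2 * ((M : ℝ) + 1) + 1) = p := by rw [hp, hm]; ring_nf
      have ed : (2 * ((M : ℝ) + 1) + 1) * p = m + 2 := by
        rw [hp, ← hm]; field_simp; ring
      have eq : ((M : ℝ) + 2) / (2 * ((M : ℝ) + 2) + 1) = q := by rw [hq, hm]; ring_nf
      have er : ((M : ℝ) + 2 + 1) / (2 * ((M : ℝ) + 2) + 1) = r := by rw [hr, hm]; ring_nf
      have hcases : j ≤ M + 1 ∨ j = M + 2 ∨ j = M + 3 := by omega
      rcases hcases with h | h | h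
      · have e0 : j ≠ M + 3 := by omega
        have e1 : j ≠ M + 2 := by omega
        have f0 : i ≠ M + 3 := by omega
        have f1 : i ≠ M + 2 := by omega
        have f2 : i ≠ M + 1 := by omega
        by_cases hji : j = i + 1
        · subst hji
          have g1 : i ≠ i + 1 + 1 := by omega
          have t1 : 2 * (i : ℝ) + 1 ≠ 0 := by positivity
          have t2 : 2 * ((i : ℝ) + 1) + 1 ≠ 0 := by positivity
          simp only [A, closureMatrix, d, l, μ, e0, e1, f0, f1, f2, g1, if_true, if_false]
          push_cast
          field_simp
          ring
        · have g1 : i ≠ j + 1 := by omega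
          simp [A, closureMatrix, d, l, μ, e0, e1, f0, f1, f2, g1, hji]
      · subst h
        have f0 : i ≠ M + 3 := by omega
        have f1 : i ≠ M + 2 := by omega
        by_cases hi1 : i = M + 1
        · subst hi1
          simp [A, closureMatrix, d, l, μ, ep, eq]
          rw [ed]
          linarith [I1]
        · have g1 : M + 2 ≠ i + 1 := by omega
          have g2 : i ≠ M + 2 + 1 := by omega
          have g3 : M + 1 ≠ i := by omega
          simp [A, closureMatrix, d, l, μ, f0, f1, hi1, g1, g2, g3]
      · subst h
        have f0 : i ≠ M + 3 := by omega
        by_cases hi2 : i = M + 2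
        · subst hi2
          simp [A, closureMatrix, d, l, μ, er]
          linarith [I3]
        · by_cases hi1 : i = M + 1
          · subst hi1
            simp [A, closureMatrix, d, l, μ]
            rw [← I2]; ring
          · have g1 : M + 3 ≠ i + 1 := by omega
            have g2 : i ≠ M + 3 + 1 := by omega
            have g3 : M + 2 ≠ i := by omega
            simp [A, closureMatrix, d, l, μ, f0, hi1, hi2, g1, g2, g3]
    ext i j
    rw [transpose_apply, hentry, hentry]
    rcases lt_trichotomy (i : ℕ) j with h | h | h
    · exact (key i j h).symm
    · rw [Fin.ext h]
    · exact key j i h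
  refine ⟨diagonal d + w • vecMulVec l l, hpd, ?_, ?_, hsym, realDiag_of_symmetrizer _ _ hpd hsym⟩
  · intro i j hi hij
    have h1 : (i : ℕ) ≠ M + 3 := by omega
    have h2 : (i : ℕ) ≠ M + 2 := by omega
    have h3 : (i : ℕ) ≠ M + 1 := by omega
    simp [diagonal_apply, hij, vecMulVec_apply, l, h1, h2, h3]
  · intro i hi
    have h1 : (i : ℕ) ≠ M + 3 := by omega
    have h2 : (i : ℕ) ≠ M + 2 := by omega
    have h3 : (i : ℕ) ≠ M + 1 := by omega
    simp [vecMulVec_apply, l, d, h1, h2, h3]
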